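/- Let f be an analytic function on 𝔻 with f(z) = z + Σ_{n≥2} a_n z^n and Re f'(z) > 0 for all z ∈ 𝔻 (i.e. f ∈ ℛ), and let Γ_1, Γ_2 be its logarithmic inverse coefficients. Then −1/3 ≤ |Γ_2| − |Γ_1| ≤ 1/3. Both inequalities are sharp. -/

import Mathlib

open Metric Filter Set

/-- The class `ℛ` of functions of bounded turning: analytic
`f(z) = z + ∑_{n≥2} aₙ zⁿ` on the unit disk with `Re f'(z) > 0`. -/
def IsR (a : ℕ → ℂ) (f : ℂ → ℂ) : Prop :=
  a 0 = 0 ∧ a 1 = 1 ∧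
  (∀ z ∈ Metric.ball (0 : ℂ) 1, HasSum (fun n => a n * z ^ n) (f z)) ∧
  ∀ z ∈ Metric.ball (0 : ℂ) 1, 0 < (deriv f z).re

/-- The derivative form of the **Schwarz–Pick lemma** at the origin. -/
theorem norm_deriv_zero_le_one_sub_sq {ψ : ℂ → ℂ} (hd : DifferentiableOn ℂ ψ (ball 0 1))
    (hψ : ∀ z ∈ ball (0 : ℂ) 1, ‖ψ z‖ ≤ 1) : ‖deriv ψ 0‖ ≤ 1 - ‖ψ 0‖ ^ 2 := by
  have h0 : (0 : ℂ) ∈ ball (0 : ℂ) 1 := by simp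
  have hnhds : ball (0 : ℂ) 1 ∈ nhds (0 : ℂ) := isOpen_ball.mem_nhds h0
  have hd0 : DifferentiableAt ℂ ψ 0 := hd.differentiableAt hnhds
  rcases (hψ 0 h0).lt_or_eq with hlt | heq
  · set w := ψ 0 with hw
    have hden : ∀ z ∈ ball (0 : ℂ) 1, 1 - starRingEnd ℂ w * ψ z ≠ 0 := by
      intro z hz h
      have h1 : ‖starRingEnd ℂ w * ψ z‖ = 1 := by rw [← sub_eq_zero.mp h, norm_one]
      rw [norm_mul, RCLike.norm_conj] at h1
      nlinarith [hψ z hz, norm_nonneg w, norm_nonneg (ψ z)]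
    set χ : ℂ → ℂ := fun z => (ψ z - w) / (1 - starRingEnd ℂ w * ψ z) with hχ
    have hχ0 : χ 0 = 0 := by simp [hχ, ← hw]
    have hχd : DifferentiableOn ℂ χ (ball 0 1) :=
      (hd.sub_const w).div ((hd.const_mul _).const_sub 1) hden
    have hmaps : MapsTo χ (ball 0 1) (closedBall (χ 0) 1) := by
      intro z hz
      rw [hχ0, mem_closedBall_zero_iff]
      simp only [hχ]
      rw [norm_div, div_le_one (norm_pos_iff.mpr (hden z hz)), ← sq_le_sq₀ (norm_nonneg _)
        (norm_nonneg _), ← Complex.normSq_eq_norm_sq, ← Complex.normSq_eq_norm_sq]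
      have h1 : Complex.normSq (ψ z) ≤ 1 := by
        rw [Complex.normSq_eq_norm_sq]; nlinarith [hψ z hz, norm_nonneg (ψ z)]
      have h2 : Complex.normSq w ≤ 1 := by
        rw [Complex.normSq_eq_norm_sq]; nlinarith [norm_nonneg w]
      have h3 := mul_nonneg (sub_nonneg.mpr h1) (sub_nonneg.mpr h2)
      simp only [Complex.normSq_apply, Complex.sub_re, Complex.sub_im, Complex.mul_re,
        Complex.mul_im, Complex.conj_re, Complex.conj_im, Complex.one_re, Complex.one_im] at h3 ⊢
      linarith
    have hχ' : HasDerivAt χ (deriv ψ 0 / (1 - starRingEnd ℂ w * w)) 0 := by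
      have hne : 1 - starRingEnd ℂ w * w ≠ 0 := hden 0 h0
      convert! (hd0.hasDerivAt.sub_const w).div
        ((hd0.hasDerivAt.const_mul (starRingEnd ℂ w)).const_sub 1) (hden 0 h0) using 1
      rw [← hw]
      field_simp
      ring
    have h := Complex.norm_deriv_le_one_of_mapsTo_ball hχd hmaps one_pos
    have hpos : 0 < 1 - ‖w‖ ^ 2 := by nlinarith [norm_nonneg w]
    have hnorm : ‖1 - starRingEnd ℂ w * w‖ = 1 - ‖w‖ ^ 2 := by
      rw [← Complex.normSq_eq_conj_mul_self, Complex.normSq_eq_norm_sq, ← Complex.ofReal_one,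
        ← Complex.ofReal_sub, Complex.norm_real, Real.norm_of_nonneg hpos.le]
    rwa [hχ'.deriv, norm_div, hnorm, div_le_one hpos] at h
  · have hmax : IsLocalMax (norm ∘ ψ) 0 := by
      filter_upwards [hnhds] with z hz
      simpa [heq] using hψ z hz
    have hconst := Complex.eventually_eq_of_isLocalMax_norm
      (by filter_upwards [hnhds] with z hz using
        hd.differentiableAt (isOpen_ball.mem_nhds hz)) hmax
    rw [Filter.EventuallyEq.deriv_eq (f := fun _ => ψ 0) hconst]
    simp [heq]

theorem deriv_and_deriv_deriv_of_eventuallyEq_const_add_mul {p h : ℂ → ℂ} {c : ℂ}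
    (hh : AnalyticAt ℂ h 0) (hp : p =ᶠ[nhds 0] fun z => c + z * h z) :
    deriv p 0 = h 0 ∧ deriv (deriv p) 0 = 2 * deriv h 0 := by
  have hp' : deriv p =ᶠ[nhds 0] fun z => h z + z * deriv h z := by
    refine hp.deriv.trans ?_
    filter_upwards [hh.eventually_analyticAt] with z hz
    simpa using (((hasDerivAt_id z).mul hz.differentiableAt.hasDerivAt).const_add c).deriv
  refine ⟨by simpa using hp'.eq_of_nhds, ?_⟩
  rw [hp'.deriv_eq]
  have := (hh.differentiableAt.hasDerivAt.add
    ((hasDerivAt_id (0 : ℂ)).mul hh.deriv.differentiableAt.hasDerivAt)).deriv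
  simp only [id, zero_mul, one_mul, add_zero] at this
  rw [two_mul]
  exact this

/-- The first two coefficients of a Carathéodory function, in terms of the Schwarz function. -/
theorem exists_norm_le_of_re_pos {p : ℂ → ℂ} (hd : DifferentiableOn ℂ p (ball 0 1))
    (hp0 : p 0 = 1) (hre : ∀ z ∈ ball (0 : ℂ) 1, 0 < (p z).re) :
    ∃ w v : ℂ, ‖w‖ ≤ 1 ∧ ‖v‖ ≤ 1 - ‖w‖ ^ 2 ∧ deriv p 0 = 2 * w ∧
      deriv (deriv p) 0 = 4 * (v + w ^ 2) := by
  have h0 : (0 : ℂ) ∈ ball (0 : ℂ) 1 := by simp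
  have hnhds : ball (0 : ℂ) 1 ∈ nhds (0 : ℂ) := isOpen_ball.mem_nhds h0
  have hne : ∀ z ∈ ball (0 : ℂ) 1, p z + 1 ≠ 0 := by
    intro z hz h
    have := congrArg Complex.re h
    simp only [Complex.add_re, Complex.one_re, Complex.zero_re] at this
    linarith [hre z hz]
  set φ : ℂ → ℂ := fun z => (p z - 1) / (p z + 1) with hφ
  have hφ0 : φ 0 = 0 := by simp [hφ, hp0]
  have hφd : DifferentiableOn ℂ φ (ball 0 1) := (hd.sub_const 1).div (hd.add_const 1) hne
  have hmaps : MapsTo φ (ball 0 1) (closedBall (φ 0) 1) := by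
    intro z hz
    rw [hφ0, mem_closedBall_zero_iff]
    simp only [hφ]
    rw [norm_div, div_le_one (norm_pos_iff.mpr (hne z hz)), ← sq_le_sq₀ (norm_nonneg _)
      (norm_nonneg _), ← Complex.normSq_eq_norm_sq, ← Complex.normSq_eq_norm_sq]
    have := hre z hz
    simp only [Complex.normSq_apply, Complex.sub_re, Complex.sub_im, Complex.add_re,
      Complex.add_im, Complex.one_re, Complex.one_im]
    linarith
  set ψ := dslope φ 0 with hψ
  have hψd : DifferentiableOn ℂ ψ (ball 0 1) := (Complex.differentiableOn_dslope hnhds).mpr hφd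
  have hψ1 : ∀ z ∈ ball (0 : ℂ) 1, ‖ψ z‖ ≤ 1 := fun z hz => by
    simpa using Complex.norm_dslope_le_div_of_mapsTo_ball hφd hmaps hz
  have heq : p =ᶠ[nhds 0] fun z => 1 + z * (ψ z * (p z + 1)) := by
    filter_upwards [hnhds] with z hz
    have h1 : z * ψ z = φ z := by simpa using sub_smul_dslope_of_zero hφ0 z
    have h2 : φ z * (p z + 1) = p z - 1 := div_mul_cancel₀ _ (hne z hz)
    rw [← mul_assoc, h1, h2]
    ring
  have hψa : AnalyticAt ℂ ψ 0 := hψd.analyticAt hnhds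
  have hpa : AnalyticAt ℂ p 0 := hd.analyticAt hnhds
  obtain ⟨h1, h2⟩ := deriv_and_deriv_deriv_of_eventuallyEq_const_add_mul
    (hψa.mul (hpa.add analyticAt_const)) heq
  have h3 := (hψa.differentiableAt.hasDerivAt.mul
    (hpa.differentiableAt.hasDerivAt.add_const 1)).deriv
  have h1' : deriv p 0 = 2 * ψ 0 := by rw [h1]; simp only [Pi.mul_apply, Pi.add_apply, hp0]; ring
  refine ⟨ψ 0, deriv ψ 0, hψ1 0 h0, norm_deriv_zero_le_one_sub_sq hψd hψ1, h1', ?_⟩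
  rw [h2]
  refine (congrArg (2 * ·) h3).trans ?_
  simp only [h1', hp0]
  ring

theorem coeff_eq_iteratedDeriv_div_factorial {a : ℕ → ℂ} {f : ℂ → ℂ}
    (h : ∀ z ∈ ball (0 : ℂ) 1, HasSum (fun n => a n * z ^ n) (f z)) (n : ℕ) :
    a n = iteratedDeriv n f 0 / n.factorial := by
  have h1 : HasFPowerSeriesAt f (FormalMultilinearSeries.ofScalars ℂ a) 0 := by
    rw [hasFPowerSeriesAt_iff]
    filter_upwards [ball_mem_nhds (0 : ℂ) one_pos] with z hz
    simpa [FormalMultilinearSeries.coeff_ofScalars, mul_comm] using h z hz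
  have h2 := congrArg (fun q => q.coeff n)
    (h1.eq_formalMultilinearSeries h1.analyticAt.hasFPowerSeriesAt)
  simpa [FormalMultilinearSeries.coeff_ofScalars] using h2

theorem IsR.exists_coeff_eq {a : ℕ → ℂ} {f : ℂ → ℂ} (hf : IsR a f) :
    ∃ w v : ℂ, ‖w‖ ≤ 1 ∧ ‖v‖ ≤ 1 - ‖w‖ ^ 2 ∧ a 2 = w ∧ a 3 = 2 / 3 * (v + w ^ 2) := by
  obtain ⟨-, ha1, hs, hre⟩ := hf
  have hd : DifferentiableOn ℂ f (ball 0 1) := fun z hz =>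
    (differentiableAt_of_deriv_ne_zero fun h => by simpa [h] using hre z hz).differentiableWithinAt
  have hc := coeff_eq_iteratedDeriv_div_factorial hs
  have hp0 : deriv f 0 = 1 := by simpa [ha1, iteratedDeriv_one] using (hc 1).symm
  obtain ⟨w, v, hw, hv, h1, h2⟩ := exists_norm_le_of_re_pos (hd.deriv isOpen_ball) hp0 hre
  refine ⟨w, v, hw, hv, ?_, ?_⟩
  · rw [hc 2, iteratedDeriv_succ, iteratedDeriv_one, h1]
    simp [Nat.factorial]
  · rw [hc 3, iteratedDeriv_succ, iteratedDeriv_succ, iteratedDeriv_one, h2]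
    simp only [Nat.factorial]
    push_cast
    ring

/-- Power series coefficients of the primitive of
`t (1 + z) / (1 - z) + (1 - t) (1 - z) / (1 + z)`. -/
noncomputable def extremalCoeff (t : ℝ) (n : ℕ) : ℂ :=
  2 * t / n - 2 * (1 - t) * ((-1) ^ n / n) - if n = 1 then 1 else 0

/-- The primitive of `t (1 + z) / (1 - z) + (1 - t) (1 - z) / (1 + z)` vanishing at `0`. -/
noncomputable def extremalFun (t : ℝ) (z : ℂ) : ℂ :=
  2 * t * -Complex.log (1 - z) - 2 * (1 - t) * -Complex.log (1 + z) - z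

theorem half_lt_re_inv_one_sub {z : ℂ} (hz : ‖z‖ < 1) : 1 / 2 < ((1 - z)⁻¹).re := by
  have h1 : Complex.normSq z < 1 := by
    rw [Complex.normSq_eq_norm_sq]; nlinarith [norm_nonneg z]
  have hne : 1 - z ≠ 0 := by
    intro h
    rw [← sub_eq_zero.mp h] at hz
    simp at hz
  rw [Complex.inv_re, div_lt_div_iff₀ two_pos (Complex.normSq_pos.mpr hne)]
  simp only [Complex.normSq_apply, Complex.sub_re, Complex.sub_im, Complex.one_re,
    Complex.one_im] at h1 ⊢
  linarith

theorem isR_extremal {t : ℝ} (h0 : 0 < t) (h1 : t < 1) :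
    IsR (extremalCoeff t) (extremalFun t) := by
  refine ⟨by simp [extremalCoeff], by simp [extremalCoeff]; ring, fun z hz => ?_, fun z hz => ?_⟩
  · rw [mem_ball_zero_iff] at hz
    have hs1 := (Complex.hasSum_taylorSeries_neg_log hz).mul_left (2 * t : ℂ)
    have hs2 := (Complex.hasSum_taylorSeries_neg_log (z := -z) (by simpa using hz)).mul_left
      (2 * (1 - t) : ℂ)
    rw [sub_neg_eq_add] at hs2
    have hs3 := hasSum_ite_eq 1 z
    convert! (hs1.sub hs2).sub hs3 using 1
    ext n
    simp only [extremalCoeff]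
    rw [neg_pow z n]
    split_ifs with h
    · subst h; ring
    · ring
  · rw [mem_ball_zero_iff] at hz
    have hz' : ‖-z‖ < 1 := by simpa using hz
    have hm1 : 1 - z ∈ Complex.slitPlane := by
      simpa [sub_eq_add_neg] using Complex.mem_slitPlane_of_norm_lt_one hz'
    have hm2 : 1 + z ∈ Complex.slitPlane := Complex.mem_slitPlane_of_norm_lt_one hz
    have hD : HasDerivAt (extremalFun t)
        (2 * t * -(-1 / (1 - z)) - 2 * (1 - t) * -(1 / (1 + z)) - 1) z :=
      (((((hasDerivAt_id z).const_sub 1).clog hm1).neg.const_mul _).sub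
        ((((hasDerivAt_id z).const_add 1).clog hm2).neg.const_mul _)).sub (hasDerivAt_id z)
    have hre1 := half_lt_re_inv_one_sub hz
    have hre2 := half_lt_re_inv_one_sub hz'
    rw [sub_neg_eq_add] at hre2
    have heq : 2 * t * -(-1 / (1 - z)) - 2 * (1 - t) * -(1 / (1 + z)) - 1 =
        ((2 * t : ℝ) : ℂ) * (1 - z)⁻¹ + ((2 * (1 - t) : ℝ) : ℂ) * (1 + z)⁻¹ - 1 := by
      push_cast
      ring
    rw [hD.deriv, heq, Complex.sub_re, Complex.add_re, Complex.re_ofReal_mul,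
      Complex.re_ofReal_mul, Complex.one_re]
    nlinarith [mul_pos h0 (sub_pos.mpr hre1), mul_pos (sub_pos.mpr h1) (sub_pos.mpr hre2)]

theorem stmt9 (a : ℕ → ℂ) (f : ℂ → ℂ) (hf : IsR a f) :
    -- with `Γ₁ = -a₂/2` and `Γ₂ = -(1/2)(a₃ - (3/2)a₂²)`
    (-(1 / 3 : ℝ) ≤ ‖-(1 / 2 : ℂ) * (a 3 - (3 / 2 : ℂ) * (a 2) ^ 2)‖ - ‖-(a 2) / 2‖ ∧
      ‖-(1 / 2 : ℂ) * (a 3 - (3 / 2 : ℂ) * (a 2) ^ 2)‖ - ‖-(a 2) / 2‖ ≤ 1 / 3) ∧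
    -- sharpness of the upper bound
    (∃ b g, IsR b g ∧
      ‖-(1 / 2 : ℂ) * (b 3 - (3 / 2 : ℂ) * (b 2) ^ 2)‖ - ‖-(b 2) / 2‖ = 1 / 3) ∧
    -- sharpness of the lower bound
    (∃ b g, IsR b g ∧
      ‖-(1 / 2 : ℂ) * (b 3 - (3 / 2 : ℂ) * (b 2) ^ 2)‖ - ‖-(b 2) / 2‖
        = -(1 / 3 : ℝ)) := by
  refine ⟨?_, ⟨_, _, isR_extremal (t := 1 / 2) (by norm_num) (by norm_num), ?_⟩,
    ⟨_, _, isR_extremal (t := 5 / 6) (by norm_num) (by norm_num), ?_⟩⟩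
  · obtain ⟨w, v, hw, hv, h2, h3⟩ := hf.exists_coeff_eq
    have heq : -(1 / 2 : ℂ) * (a 3 - (3 / 2 : ℂ) * (a 2) ^ 2) =
        (5 / 12 : ℂ) * w ^ 2 - (1 / 3 : ℂ) * v := by
      rw [h2, h3]; ring
    have hn1 : ‖(5 / 12 : ℂ) * w ^ 2‖ = 5 / 12 * ‖w‖ ^ 2 := by simp
    have hn2 : ‖(1 / 3 : ℂ) * v‖ = 1 / 3 * ‖v‖ := by simp
    have hn3 : ‖-w / 2‖ = ‖w‖ / 2 := by simp
    have hup := norm_sub_le ((5 / 12 : ℂ) * w ^ 2) ((1 / 3 : ℂ) * v)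
    have hlow := norm_sub_norm_le ((5 / 12 : ℂ) * w ^ 2) ((1 / 3 : ℂ) * v)
    have hnn := norm_nonneg ((5 / 12 : ℂ) * w ^ 2 - (1 / 3 : ℂ) * v)
    rw [hn1, hn2] at hup hlow
    rw [heq, h2, hn3]
    have hw0 := norm_nonneg w
    constructor
    · rcases le_total ‖w‖ (2 / 3) with h | h
      · linarith
      · nlinarith
    · nlinarith
  · norm_num [extremalCoeff]
  · norm_num [extremalCoeff]
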